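/- There exists a C¹ orientation-preserving diffeomorphism of the circle 𝕊¹ whose rotation number is an irrational number of constant type and which is not minimal: some orbit is not dense in 𝕊¹ (equivalently, it admits a wandering interval and is not topologically conjugate to a rotation). -/

import Mathlib

open MeasureTheory Set
noncomputable section

/-- A real number is of constant type if it is irrational and the partial quotients
of its continued fraction expansion are bounded. -/
def IsOfConstantType (ω : ℝ) : Prop :=
  Irrational ω ∧ ∃ B : ℝ, ∀ n : ℕ, ∀ a ∈ (GenContFract.of ω).partDens.get? n, a ≤ B

open Filter Topology

/-! ### The golden ratio is of constant type -/

theorem stream_goldenRatio (n : ℕ) :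
    GenContFract.IntFractPair.stream Real.goldenRatio n =
      some (GenContFract.IntFractPair.of Real.goldenRatio) := by
  have hfract : Int.fract Real.goldenRatio = Real.goldenRatio - 1 := by
    rw [Int.fract_eq_iff]
    exact ⟨by linarith [Real.one_lt_goldenRatio], by linarith [Real.goldenRatio_lt_two],
      1, by norm_num⟩
  have hne : Real.goldenRatio - 1 ≠ 0 := by linarith [Real.one_lt_goldenRatio]
  have hinv : (Real.goldenRatio - 1)⁻¹ = Real.goldenRatio :=
    inv_eq_of_mul_eq_one_left <| by linarith [Real.goldenRatio_sq]
  induction n with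
  | zero => rfl
  | succ n ih =>
    rw [GenContFract.IntFractPair.stream_succ (by rwa [hfract]), hfract, hinv, ih]

theorem isOfConstantType_goldenRatio : IsOfConstantType Real.goldenRatio := by
  refine ⟨Real.goldenRatio_irrational,
    ((GenContFract.IntFractPair.of Real.goldenRatio).b : ℝ), fun n a ha => ?_⟩
  obtain ⟨gp, hgp, rfl⟩ := GenContFract.exists_s_b_of_partDen ha
  rw [GenContFract.get?_of_eq_some_of_succ_get?_intFractPair_stream
    (stream_goldenRatio (n + 1))] at hgp
  cases hgp
  exact le_rfl

/-! ### A smoothed staircase -/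

/-- The continuous bump `6 u (1 - u)` on `[0, 1]`, of total mass one, extended by zero. -/
def bump (u : ℝ) : ℝ := max 0 (6 * (u * (1 - u)))

theorem bump_nonneg (u : ℝ) : 0 ≤ bump u := le_max_left _ _

theorem bump_le (u : ℝ) : bump u ≤ 3 / 2 :=
  max_le (by norm_num) (by nlinarith [sq_nonneg (2 * u - 1)])

theorem bump_eq_zero_of_one_le {u : ℝ} (hu : 1 ≤ u) : bump u = 0 :=
  max_eq_left (by nlinarith)

theorem bump_zero : bump 0 = 0 := by simp [bump]

theorem continuous_bump : Continuous bump := by unfold bump; fun_prop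

/-- The `1`-periodic pulse train of unit mass per period supported on `[1 - ℓ, 1] + ℤ`. -/
def pulse (ℓ y : ℝ) : ℝ := bump ((1 - Int.fract y) / ℓ) / ℓ

theorem pulse_periodic (ℓ : ℝ) : Function.Periodic (pulse ℓ) 1 := fun y => by
  simp [pulse]

theorem pulse_nonneg {ℓ : ℝ} (hℓ : 0 < ℓ) (y : ℝ) : 0 ≤ pulse ℓ y :=
  div_nonneg (bump_nonneg _) hℓ.le

theorem mul_pulse_le {ℓ : ℝ} (hℓ : 0 < ℓ) (y : ℝ) : ℓ * pulse ℓ y ≤ 3 / 2 := by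
  rw [pulse, mul_div_cancel₀ _ hℓ.ne']
  exact bump_le _

theorem pulse_eq_zero {ℓ y : ℝ} (hℓ : 0 < ℓ) (hy : Int.fract y ≤ 1 - ℓ) : pulse ℓ y = 0 := by
  rw [pulse, bump_eq_zero_of_one_le, zero_div]
  rw [le_div_iff₀ hℓ]
  linarith

theorem continuous_pulse {ℓ : ℝ} (hℓ : 0 < ℓ) (hℓ' : ℓ ≤ 1) : Continuous (pulse ℓ) := by
  refine ContinuousOn.comp_fract'' (f := fun u => bump ((1 - u) / ℓ) / ℓ) ?_ ?_
  · exact ((continuous_bump.comp (by fun_prop)).div_const ℓ).continuousOn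
  · have h : 1 ≤ 1 / ℓ := by rwa [le_div_iff₀ hℓ, one_mul]
    simp [bump_eq_zero_of_one_le (one_div ℓ ▸ h), bump_zero]

theorem integral_pulse_eq_zero {ℓ y : ℝ} (hℓ : 0 < ℓ) (hy₀ : 0 ≤ y) (hy : y ≤ 1 - ℓ) :
    ∫ x in (0 : ℝ)..y, pulse ℓ x = 0 := by
  refine (intervalIntegral.integral_congr fun x hx => ?_).trans intervalIntegral.integral_zero
  rw [uIcc_of_le hy₀] at hx
  refine pulse_eq_zero hℓ ?_
  rw [Int.fract_eq_self.2 ⟨hx.1, by linarith [hx.2]⟩]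
  exact hx.2.trans hy

theorem integral_pulse_period {ℓ : ℝ} (hℓ : 0 < ℓ) (hℓ' : ℓ ≤ 1) :
    ∫ x in (0 : ℝ)..1, pulse ℓ x = 1 := by
  have hint := fun a b => (continuous_pulse hℓ hℓ').intervalIntegrable (μ := volume) a b
  rw [← intervalIntegral.integral_add_adjacent_intervals (hint 0 (1 - ℓ)) (hint (1 - ℓ) 1),
    integral_pulse_eq_zero hℓ (by linarith) le_rfl, zero_add]
  have hcongr : ∀ x ∈ uIcc (1 - ℓ) 1,
      pulse ℓ x = 6 * ((1 - x) / ℓ * (1 - (1 - x) / ℓ)) / ℓ := fun x hx => by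
    rw [uIcc_of_le (by linarith)] at hx
    rcases hx.2.eq_or_lt with rfl | hlt
    · rw [pulse, Int.fract_one, sub_zero, bump_eq_zero_of_one_le (by rwa [le_div_iff₀ hℓ, one_mul])]
      simp
    · have h1 : (1 - x) / ℓ ≤ 1 := by rw [div_le_one hℓ]; linarith [hx.1]
      have h2 : 0 ≤ (1 - x) / ℓ := div_nonneg (by linarith) hℓ.le
      rw [pulse, Int.fract_eq_self.2 ⟨by linarith [hx.1], hlt⟩, bump, max_eq_right]
      exact mul_nonneg (by norm_num) (mul_nonneg h2 (by linarith))
  rw [intervalIntegral.integral_congr hcongr,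
    intervalIntegral.integral_eq_sub_of_hasDerivAt
      (f := fun x => 2 * ((1 - x) / ℓ) ^ 3 - 3 * ((1 - x) / ℓ) ^ 2)]
  · simp [hℓ.ne']
    norm_num
  · intro x _
    have h : HasDerivAt (fun x : ℝ => (1 - x) / ℓ) (-1 / ℓ) x :=
      ((hasDerivAt_id x).const_sub 1).div_const ℓ
    refine (((h.fun_pow 3).const_mul 2).sub ((h.fun_pow 2).const_mul 3)).congr_deriv ?_
    push_cast
    ring
  · exact Continuous.intervalIntegrable (by fun_prop) _ _

/-- The smoothed staircase: it equals `n` on `[n, n + 1 - ℓ]` and climbs by one on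
`[n + 1 - ℓ, n + 1]`. -/
def ramp (ℓ y : ℝ) : ℝ := ∫ x in (0 : ℝ)..y, pulse ℓ x

theorem hasDerivAt_ramp {ℓ : ℝ} (hℓ : 0 < ℓ) (hℓ' : ℓ ≤ 1) (y : ℝ) :
    HasDerivAt (ramp ℓ) (pulse ℓ y) y :=
  (continuous_pulse hℓ hℓ').integral_hasStrictDerivAt 0 y |>.hasDerivAt

theorem monotone_ramp {ℓ : ℝ} (hℓ : 0 < ℓ) (hℓ' : ℓ ≤ 1) : Monotone (ramp ℓ) :=
  monotone_of_hasDerivAt_nonneg (hasDerivAt_ramp hℓ hℓ') (pulse_nonneg hℓ)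

theorem ramp_add_one {ℓ : ℝ} (hℓ : 0 < ℓ) (hℓ' : ℓ ≤ 1) (y : ℝ) :
    ramp ℓ (y + 1) = ramp ℓ y + 1 := by
  unfold ramp
  rw [(pulse_periodic ℓ).intervalIntegral_add_eq_add 0 y
    fun a b => (continuous_pulse hℓ hℓ').intervalIntegrable a b, zero_add,
    integral_pulse_period hℓ hℓ']

theorem ramp_eq_ramp_fract_add_floor {ℓ : ℝ} (hℓ : 0 < ℓ) (hℓ' : ℓ ≤ 1) (y : ℝ) :
    ramp ℓ y = ramp ℓ (Int.fract y) + ⌊y⌋ := by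
  have hper : Function.Periodic (fun z => ramp ℓ z - z) 1 := fun z => by
    simp only [ramp_add_one hℓ hℓ']
    ring
  have h := hper.int_mul ⌊y⌋ (Int.fract y)
  simp only [mul_one, Int.fract_add_floor] at h
  linarith [Int.fract_add_floor y]

theorem ramp_eq_floor {ℓ y : ℝ} (hℓ : 0 < ℓ) (hℓ' : ℓ ≤ 1) (hy : Int.fract y ≤ 1 - ℓ) :
    ramp ℓ y = ⌊y⌋ := by
  rw [ramp_eq_ramp_fract_add_floor hℓ hℓ', ramp,
    integral_pulse_eq_zero hℓ (Int.fract_nonneg y) hy, zero_add]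

theorem abs_ramp_le {ℓ : ℝ} (hℓ : 0 < ℓ) (hℓ' : ℓ ≤ 1) (y : ℝ) : |ramp ℓ y| ≤ |y| + 1 := by
  have h0 : ramp ℓ 0 = 0 := by simp [ramp]
  have h1 : ramp ℓ 1 = 1 := by simpa [h0] using ramp_add_one hℓ hℓ' 0
  have hlow := monotone_ramp hℓ hℓ' (Int.fract_nonneg y)
  have hupp := monotone_ramp hℓ hℓ' (Int.fract_lt_one y).le
  have heq := ramp_eq_ramp_fract_add_floor hℓ hℓ' y
  have hfloor := Int.floor_le y
  have hfloor' := Int.lt_floor_add_one y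
  rw [abs_le]
  constructor <;> cases abs_cases y <;> linarith

/-! ### Uniform convergence of series with disjoint supports -/

theorem tendstoUniformly_sum_of_disjoint_support {ι X : Type*} {f : ι → X → ℝ} {c : ι → ℝ}
    (hdisj : ∀ x i j, f i x ≠ 0 → f j x ≠ 0 → i = j) (hbound : ∀ i x, |f i x| ≤ c i)
    (hc : Tendsto c cofinite (𝓝 0)) :
    TendstoUniformly (fun (s : Finset ι) x => ∑ i ∈ s, f i x) (fun x => ∑' i, f i x) atTop := by
  classical
  rw [Metric.tendstoUniformly_iff]
  intro ε hε
  have hfin : {i | ¬ c i < ε}.Finite := hc.eventually (gt_mem_nhds hε)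
  filter_upwards [eventually_ge_atTop hfin.toFinset] with s hs x
  by_cases h : ∃ i, f i x ≠ 0
  · obtain ⟨i, hi⟩ := h
    have hother : ∀ j, j ≠ i → f j x = 0 := fun j hj => by
      by_contra hne
      exact hj (hdisj x j i hne hi)
    rw [tsum_eq_single i hother]
    by_cases his : i ∈ s
    · rw [Finset.sum_eq_single i (fun j _ => hother j) (fun h => (h his).elim), dist_self]
      exact hε
    · rw [Finset.sum_eq_zero fun j hj => hother j (by rintro rfl; exact his hj), dist_zero_right,
        Real.norm_eq_abs]
      refine (hbound i x).trans_lt ?_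
      by_contra hlt
      exact his (hs (hfin.mem_toFinset.2 hlt))
  · push Not at h
    simpa [h] using hε

/-- A sum of functions with disjoint supports inherits a nonpositive lower bound. -/
theorem le_tsum_of_disjoint_support {ι : Type*} {f : ι → ℝ} {c : ℝ} (hc : c ≤ 0)
    (hdisj : ∀ i j, f i ≠ 0 → f j ≠ 0 → i = j) (hbound : ∀ i, c ≤ f i) : c ≤ ∑' i, f i := by
  by_cases h : ∃ i, f i ≠ 0
  · obtain ⟨i, hi⟩ := h
    rw [tsum_eq_single i fun j hj => by_contra fun hne => hj (hdisj j i hne hi)]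
    exact hbound i
  · push Not at h
    simpa [h] using hc

/-! ### The blow-up of an orbit of a rotation -/

/-- Lengths of the gaps inserted along an orbit of a rotation to produce a Denjoy example of
class `C¹`: they have total mass one, a finite first moment, and consecutive ratios tending
to one. -/
structure IsGapLength (ℓ : ℤ → ℝ) : Prop where
  pos : ∀ n, 0 < ℓ n
  hasSum : HasSum ℓ 1
  summable_abs_mul : Summable fun n : ℤ => |(n : ℝ)| * ℓ n
  le_two_mul : ∀ n, ℓ n ≤ 2 * ℓ (n + 1)
  tendsto_ratio : Tendsto (fun n => ℓ (n + 1) / ℓ n - 1) cofinite (𝓝 0)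

/-- The increasing map with a jump of size `ℓ n` at each point of `n α + ℤ`. -/
def jumpSum (ℓ : ℤ → ℝ) (α t : ℝ) : ℝ := ∑' n : ℤ, ℓ n * ⌊t - n * α⌋

namespace IsGapLength

variable {ℓ : ℤ → ℝ}

theorem le_one (h : IsGapLength ℓ) (n : ℤ) : ℓ n ≤ 1 :=
  le_hasSum h.hasSum n fun k _ => (h.pos k).le

theorem hasSum_succ (h : IsGapLength ℓ) : HasSum (fun n => ℓ (n + 1)) 1 :=
  (Equiv.addRight (1 : ℤ)).hasSum_iff.2 h.hasSum

theorem summable_mul (h : IsGapLength ℓ) {u : ℤ → ℝ} {A B : ℝ}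
    (hu : ∀ n : ℤ, |u n| ≤ A + B * |(n : ℝ)|) : Summable fun n => ℓ n * u n := by
  refine Summable.of_norm_bounded
    ((h.hasSum.summable.mul_left A).add (h.summable_abs_mul.mul_left B)) fun n => ?_
  rw [Real.norm_eq_abs, abs_mul, abs_of_pos (h.pos n)]
  calc ℓ n * |u n| ≤ ℓ n * (A + B * |(n : ℝ)|) := mul_le_mul_of_nonneg_left (hu n) (h.pos n).le
    _ = A * ℓ n + B * (|(n : ℝ)| * ℓ n) := by ring

theorem summable_succ_mul (h : IsGapLength ℓ) {u : ℤ → ℝ} {A B : ℝ} (hB : 0 ≤ B)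
    (hu : ∀ n : ℤ, |u n| ≤ A + B * |(n : ℝ)|) : Summable fun n => ℓ (n + 1) * u n := by
  have hs : Summable fun n => ℓ n * u (n - 1) := by
    refine h.summable_mul (A := A + B) (B := B) fun n => (hu (n - 1)).trans ?_
    have habs : |((n - 1 : ℤ) : ℝ)| ≤ |(n : ℝ)| + 1 := by
      push_cast
      simpa using abs_sub (n : ℝ) 1
    nlinarith
  simpa [Function.comp_def] using (Equiv.addRight (1 : ℤ)).summable_iff.2 hs

theorem abs_floor_sub_le (α t : ℝ) (n : ℤ) :
    |(⌊t - n * α⌋ : ℝ)| ≤ (|t| + 1) + |α| * |(n : ℝ)| := by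
  have h1 : |t - n * α| ≤ |t| + |(n : ℝ)| * |α| := by
    rw [← abs_mul]
    exact abs_sub _ _
  have h2 := Int.floor_le (t - n * α)
  have h3 := Int.lt_floor_add_one (t - n * α)
  rw [abs_le] at h1 ⊢
  constructor <;> linarith [h1.1, h1.2]

theorem hasSum_jumpSum (h : IsGapLength ℓ) (α t : ℝ) :
    HasSum (fun n : ℤ => ℓ n * ⌊t - n * α⌋) (jumpSum ℓ α t) :=
  (h.summable_mul (abs_floor_sub_le α t)).hasSum

theorem hasSum_jumpSum_add (h : IsGapLength ℓ) (α t : ℝ) :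
    HasSum (fun n : ℤ => ℓ (n + 1) * ⌊t - n * α⌋) (jumpSum ℓ α (t + α)) := by
  convert (Equiv.addRight (1 : ℤ)).hasSum_iff.2 (h.hasSum_jumpSum α (t + α)) using 2 with n
  simp only [Function.comp_apply, Equiv.coe_addRight]
  congr 3
  push_cast
  ring

theorem jumpSum_mono (h : IsGapLength ℓ) (α : ℝ) : Monotone (jumpSum ℓ α) := fun s t hst =>
  hasSum_le (fun n => mul_le_mul_of_nonneg_left
    (Int.cast_le.2 (Int.floor_le_floor (by linarith))) (h.pos n).le)
    (h.hasSum_jumpSum α s) (h.hasSum_jumpSum α t)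

/-- `jumpSum` as a monotone (discontinuous) degree one lift. -/
def jumpLift (h : IsGapLength ℓ) (α : ℝ) : CircleDeg1Lift where
  toFun := jumpSum ℓ α
  monotone' := h.jumpSum_mono α
  map_add_one' t := by
    refine ((h.hasSum_jumpSum α t).add h.hasSum).unique ?_ |>.symm
    convert h.hasSum_jumpSum α (t + 1) using 2 with n
    rw [add_sub_right_comm, Int.floor_add_one]
    push_cast
    ring

theorem jumpSum_add_int (h : IsGapLength ℓ) (α t : ℝ) (m : ℤ) :
    jumpSum ℓ α (t + m) = jumpSum ℓ α t + m :=
  (h.jumpLift α).map_add_int t m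

theorem jumpSum_add_le (h : IsGapLength ℓ) {α t : ℝ} {k m : ℤ} (ht : t < k * α + m) :
    jumpSum ℓ α t + ℓ k ≤ jumpSum ℓ α (k * α + m) := by
  have hsum := (h.hasSum_jumpSum α (k * α + m)).sub (h.hasSum_jumpSum α t)
  have hk := le_hasSum hsum k fun n _ => by
    rw [sub_nonneg]
    exact mul_le_mul_of_nonneg_left
      (Int.cast_le.2 (Int.floor_le_floor (by linarith))) (h.pos n).le
  have hfloor : (⌊t - k * α⌋ : ℝ) + 1 ≤ m := by
    exact_mod_cast Int.add_one_le_iff.2 (Int.floor_lt.2 (by linarith))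
  rw [add_sub_cancel_left, Int.floor_intCast] at hk
  nlinarith [h.pos k]

theorem abs_jumpSum_le (h : IsGapLength ℓ) (α t : ℝ) :
    |jumpSum ℓ α t| ≤ |jumpSum ℓ α 0| + 1 + |t| := by
  have h1 : jumpSum ℓ α 0 + ⌊t⌋ ≤ jumpSum ℓ α t := (h.jumpLift α).le_map_of_map_zero t
  have h2 : jumpSum ℓ α t ≤ jumpSum ℓ α 0 + ⌈t⌉ := (h.jumpLift α).map_le_of_map_zero t
  have h3 := Int.lt_floor_add_one t
  have h4 := Int.ceil_lt_add_one t
  rw [abs_le]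
  constructor <;>
    linarith [neg_abs_le t, le_abs_self t, neg_abs_le (jumpSum ℓ α 0), le_abs_self (jumpSum ℓ α 0)]

theorem ramp_jumpSum_sub (h : IsGapLength ℓ) (α t : ℝ) (n : ℤ) :
    ramp (ℓ n) (jumpSum ℓ α t - jumpSum ℓ α (n * α)) = ⌊t - n * α⌋ := by
  have hlow : jumpSum ℓ α (n * α + ⌊t - n * α⌋) ≤ jumpSum ℓ α t :=
    h.jumpSum_mono α (by linarith [Int.floor_le (t - n * α)])
  have hupp : jumpSum ℓ α t + ℓ n ≤ jumpSum ℓ α (n * α + (⌊t - n * α⌋ + 1 : ℤ)) := by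
    refine h.jumpSum_add_le ?_
    push_cast
    linarith [Int.lt_floor_add_one (t - n * α)]
  rw [h.jumpSum_add_int] at hlow hupp
  push_cast at hupp
  have hpos := h.pos n
  have hfloor : ⌊jumpSum ℓ α t - jumpSum ℓ α (n * α)⌋ = ⌊t - n * α⌋ :=
    Int.floor_eq_iff.2 ⟨by linarith, by linarith⟩
  rw [ramp_eq_floor hpos (h.le_one n), hfloor]
  rw [Int.fract, hfloor]
  linarith

theorem exists_of_pulse_ne_zero (h : IsGapLength ℓ) {α x : ℝ} {n : ℤ}
    (hx : pulse (ℓ n) (x - jumpSum ℓ α (n * α)) ≠ 0) :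
    ∃ m : ℤ, jumpSum ℓ α (n * α + m) - ℓ n < x ∧ x < jumpSum ℓ α (n * α + m) := by
  have hfract := not_le.1 (mt (pulse_eq_zero (h.pos n)) hx)
  refine ⟨⌊x - jumpSum ℓ α (n * α)⌋ + 1, ?_⟩
  rw [h.jumpSum_add_int]
  push_cast
  rw [Int.fract] at hfract
  constructor <;> linarith [Int.lt_floor_add_one (x - jumpSum ℓ α (n * α))]

theorem eq_of_pulse_ne_zero (h : IsGapLength ℓ) {α : ℝ} (hα : Irrational α) {x : ℝ} {n k : ℤ}
    (hn : pulse (ℓ n) (x - jumpSum ℓ α (n * α)) ≠ 0)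
    (hk : pulse (ℓ k) (x - jumpSum ℓ α (k * α)) ≠ 0) : n = k := by
  obtain ⟨m, hm, hm'⟩ := h.exists_of_pulse_ne_zero hn
  obtain ⟨p, hp, hp'⟩ := h.exists_of_pulse_ne_zero hk
  rcases lt_trichotomy (n * α + m : ℝ) (k * α + p) with hlt | heq | hlt
  · linarith [h.jumpSum_add_le hlt]
  · by_contra hne
    have hirr := hα.intCast_mul (sub_ne_zero.2 hne)
    refine hirr ⟨((p - m : ℤ) : ℚ), ?_⟩
    push_cast
    linarith
  · linarith [h.jumpSum_add_le hlt]

end IsGapLength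

/-! ### The Denjoy map -/

/-- The Denjoy map blowing up the orbit of zero under the rotation by `α`: it maps the gap of
length `ℓ n` onto the gap of length `ℓ (n + 1)`. -/
def denjoyMap (ℓ : ℤ → ℝ) (α x : ℝ) : ℝ :=
  x + ∑' n : ℤ, (ℓ (n + 1) - ℓ n) * ramp (ℓ n) (x - jumpSum ℓ α (n * α))

/-- The derivative of `denjoyMap`. -/
def denjoyDeriv (ℓ : ℤ → ℝ) (α x : ℝ) : ℝ :=
  1 + ∑' n : ℤ, (ℓ (n + 1) - ℓ n) * pulse (ℓ n) (x - jumpSum ℓ α (n * α))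

namespace IsGapLength

variable {ℓ : ℤ → ℝ}

theorem hasSum_denjoyMap (h : IsGapLength ℓ) (α x : ℝ) :
    HasSum (fun n : ℤ => (ℓ (n + 1) - ℓ n) * ramp (ℓ n) (x - jumpSum ℓ α (n * α)))
      (denjoyMap ℓ α x - x) := by
  have hu : ∀ n : ℤ, |ramp (ℓ n) (x - jumpSum ℓ α (n * α))| ≤
      (|x| + |jumpSum ℓ α 0| + 2) + |α| * |(n : ℝ)| := fun n => by
    have h1 := abs_ramp_le (h.pos n) (h.le_one n) (x - jumpSum ℓ α (n * α))
    have h2 := abs_sub x (jumpSum ℓ α (n * α))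
    have h3 := h.abs_jumpSum_le α (n * α)
    rw [abs_mul] at h3
    linarith
  have hs := (h.summable_succ_mul (abs_nonneg α) hu).sub (h.summable_mul hu)
  simp only [← sub_mul] at hs
  simpa [denjoyMap] using hs.hasSum

theorem denjoyMap_add_one (h : IsGapLength ℓ) (α x : ℝ) :
    denjoyMap ℓ α (x + 1) = denjoyMap ℓ α x + 1 := by
  have hs := (h.hasSum_denjoyMap α x).add (h.hasSum_succ.sub h.hasSum)
  have hs' := h.hasSum_denjoyMap α (x + 1)
  have heq : ∀ n : ℤ, (ℓ (n + 1) - ℓ n) * ramp (ℓ n) (x + 1 - jumpSum ℓ α (n * α)) =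
      (ℓ (n + 1) - ℓ n) * ramp (ℓ n) (x - jumpSum ℓ α (n * α)) + (ℓ (n + 1) - ℓ n) := fun n => by
    rw [add_sub_right_comm, ramp_add_one (h.pos n) (h.le_one n)]
    ring
  simp only [heq] at hs'
  linarith [hs.unique hs']

theorem denjoyMap_jumpSum (h : IsGapLength ℓ) (α t : ℝ) :
    denjoyMap ℓ α (jumpSum ℓ α t) = jumpSum ℓ α (t + α) := by
  have hs := h.hasSum_denjoyMap α (jumpSum ℓ α t)
  simp only [h.ramp_jumpSum_sub, sub_mul] at hs
  linarith [hs.unique ((h.hasSum_jumpSum_add α t).sub (h.hasSum_jumpSum α t))]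

theorem abs_sub_mul_pulse_le (h : IsGapLength ℓ) (n : ℤ) (y : ℝ) :
    |(ℓ (n + 1) - ℓ n) * pulse (ℓ n) y| ≤ 3 / 2 * |ℓ (n + 1) / ℓ n - 1| := by
  have hpos := h.pos n
  have heq : (ℓ (n + 1) - ℓ n) * pulse (ℓ n) y =
      (ℓ (n + 1) / ℓ n - 1) * (ℓ n * pulse (ℓ n) y) := by
    field_simp
  rw [heq, abs_mul, abs_of_nonneg (mul_nonneg hpos.le (pulse_nonneg hpos y)), mul_comm]
  exact mul_le_mul_of_nonneg_right (mul_pulse_le hpos y) (abs_nonneg _)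

theorem tendstoUniformly_denjoyDeriv (h : IsGapLength ℓ) {α : ℝ} (hα : Irrational α) :
    TendstoUniformly (fun (s : Finset ℤ) x => ∑ n ∈ s,
        (ℓ (n + 1) - ℓ n) * pulse (ℓ n) (x - jumpSum ℓ α (n * α)))
      (fun x => ∑' n : ℤ, (ℓ (n + 1) - ℓ n) * pulse (ℓ n) (x - jumpSum ℓ α (n * α))) atTop := by
  refine tendstoUniformly_sum_of_disjoint_support
    (c := fun n => 3 / 2 * |ℓ (n + 1) / ℓ n - 1|)
    (fun x n k hn hk => h.eq_of_pulse_ne_zero hα (right_ne_zero_of_mul hn)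
      (right_ne_zero_of_mul hk))
    (fun n x => h.abs_sub_mul_pulse_le n _) ?_
  simpa using h.tendsto_ratio.abs.const_mul (3 / 2)

theorem continuous_denjoyDeriv (h : IsGapLength ℓ) {α : ℝ} (hα : Irrational α) :
    Continuous (denjoyDeriv ℓ α) :=
  continuous_const.add <| (h.tendstoUniformly_denjoyDeriv hα).continuous <|
    Frequently.of_forall fun _ => continuous_finsetSum _ fun n _ => continuous_const.mul <|
      (continuous_pulse (h.pos n) (h.le_one n)).comp (continuous_id.sub continuous_const)

theorem hasDerivAt_denjoyMap (h : IsGapLength ℓ) {α : ℝ} (hα : Irrational α) (x : ℝ) :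
    HasDerivAt (denjoyMap ℓ α) (denjoyDeriv ℓ α x) x := by
  refine (hasDerivAt_id x).add (hasDerivAt_of_tendstoUniformly
    (f := fun (s : Finset ℤ) y =>
      ∑ n ∈ s, (ℓ (n + 1) - ℓ n) * ramp (ℓ n) (y - jumpSum ℓ α (n * α)))
    (h.tendstoUniformly_denjoyDeriv hα) (Eventually.of_forall fun s y => ?_) (fun y => ?_) x)
  · exact HasDerivAt.fun_sum fun n _ => ((hasDerivAt_ramp (h.pos n) (h.le_one n)
      (y - jumpSum ℓ α (n * α))).comp_sub_const y _).const_mul _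
  · exact (h.hasSum_denjoyMap α y).summable.hasSum

theorem denjoyDeriv_pos (h : IsGapLength ℓ) {α : ℝ} (hα : Irrational α) (x : ℝ) :
    0 < denjoyDeriv ℓ α x := by
  have hle : -(3 / 4 : ℝ) ≤
      ∑' n : ℤ, (ℓ (n + 1) - ℓ n) * pulse (ℓ n) (x - jumpSum ℓ α (n * α)) := by
    refine le_tsum_of_disjoint_support (by norm_num)
      (fun n k hn hk => h.eq_of_pulse_ne_zero hα (right_ne_zero_of_mul hn)
        (right_ne_zero_of_mul hk)) fun n => ?_
    have h1 := mul_pulse_le (h.pos n) (x - jumpSum ℓ α (n * α))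
    have h2 := pulse_nonneg (h.pos n) (x - jumpSum ℓ α (n * α))
    nlinarith [h.le_two_mul n]
  unfold denjoyDeriv
  linarith

theorem contDiff_denjoyMap (h : IsGapLength ℓ) {α : ℝ} (hα : Irrational α) :
    ContDiff ℝ 1 (denjoyMap ℓ α) := by
  rw [contDiff_one_iff_deriv, funext fun x => (h.hasDerivAt_denjoyMap hα x).deriv]
  exact ⟨fun x => (h.hasDerivAt_denjoyMap hα x).differentiableAt, h.continuous_denjoyDeriv hα⟩

theorem strictMono_denjoyMap (h : IsGapLength ℓ) {α : ℝ} (hα : Irrational α) :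
    StrictMono (denjoyMap ℓ α) :=
  strictMono_of_hasDerivAt_pos (h.hasDerivAt_denjoyMap hα) (h.denjoyDeriv_pos hα)

/-- `denjoyMap` as a degree one lift. -/
def denjoyLift (h : IsGapLength ℓ) {α : ℝ} (hα : Irrational α) : CircleDeg1Lift where
  toFun := denjoyMap ℓ α
  monotone' := (h.strictMono_denjoyMap hα).monotone
  map_add_one' := h.denjoyMap_add_one α

theorem isUnit_denjoyLift (h : IsGapLength ℓ) {α : ℝ} (hα : Irrational α) :
    IsUnit (h.denjoyLift hα) :=
  CircleDeg1Lift.isUnit_iff_bijective.2 ⟨(h.strictMono_denjoyMap hα).injective,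
    (h.denjoyLift hα).continuous_iff_surjective.1 (h.contDiff_denjoyMap hα).continuous⟩

theorem translationNumber_denjoyLift (h : IsGapLength ℓ) {α : ℝ} (hα : Irrational α) :
    (h.denjoyLift hα).translationNumber = α := by
  refine Eq.trans (CircleDeg1Lift.translationNumber_eq_of_semiconj (f := h.jumpLift α)
    fun t => ?_).symm (CircleDeg1Lift.translationNumber_translate α)
  change jumpSum ℓ α (CircleDeg1Lift.translate (Multiplicative.ofAdd α) t) =
    denjoyMap ℓ α (jumpSum ℓ α t)
  rw [h.denjoyMap_jumpSum, CircleDeg1Lift.translate_apply, add_comm]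

end IsGapLength

/-! ### Explicit gap lengths -/

theorem summable_one_div_five_add_abs_pow {p : ℕ} (hp : 1 < p) :
    Summable fun n : ℤ => 1 / (5 + |(n : ℝ)|) ^ p := by
  have hnat : Summable fun n : ℕ => 1 / (5 + (n : ℝ)) ^ p := by
    have hs := (summable_nat_add_iff 5).2 (Real.summable_one_div_nat_pow.2 hp)
    simpa [add_comm] using hs
  exact Summable.of_nat_of_neg (by simpa using hnat) (by simpa using hnat)

theorem exists_isGapLength : ∃ ℓ : ℤ → ℝ, IsGapLength ℓ := by
  set w : ℤ → ℝ := fun n => 1 / (5 + |(n : ℝ)|) ^ 3 with hw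
  have hbase : ∀ n : ℤ, 0 < 5 + |(n : ℝ)| := fun n => by positivity
  have hwpos : ∀ n, 0 < w n := fun n => one_div_pos.2 (pow_pos (hbase n) 3)
  have hsum : Summable w := summable_one_div_five_add_abs_pow (by norm_num)
  have htot : 0 < ∑' n, w n := hsum.tsum_pos (fun n => (hwpos n).le) 0 (hwpos 0)
  have habs : ∀ n : ℤ, |(((n + 1 : ℤ) : ℝ))| ≤ |(n : ℝ)| + 1 ∧
      |(n : ℝ)| ≤ |(((n + 1 : ℤ) : ℝ))| + 1 := fun n => by
    push_cast
    constructor <;> cases abs_cases (n : ℝ) <;> cases abs_cases (n + 1 : ℝ) <;> linarith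
  have hratio : ∀ n, w (n + 1) / w n =
      ((5 + |(n : ℝ)|) / (5 + |((n + 1 : ℤ) : ℝ)|)) ^ 3 := fun n => by
    simp only [hw, div_pow, one_div]
    rw [div_inv_eq_mul, mul_comm, div_eq_mul_inv]
  refine ⟨fun n => w n / ∑' k, w k, ⟨fun n => div_pos (hwpos n) htot, ?_, ?_, fun n => ?_, ?_⟩⟩
  · simpa [htot.ne'] using hsum.hasSum.div_const (∑' k, w k)
  · have hs : Summable fun n : ℤ => |(n : ℝ)| * w n := by
      refine Summable.of_nonneg_of_le (fun n => mul_nonneg (abs_nonneg _) (hwpos n).le)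
        (fun n => ?_) (summable_one_div_five_add_abs_pow (p := 2) (by norm_num))
      have hb := hbase n
      simp only [hw]
      rw [mul_one_div, div_le_div_iff₀ (by positivity) (by positivity)]
      nlinarith [pow_pos hb 2, abs_nonneg (n : ℝ)]
    simpa only [mul_div_assoc] using hs.div_const (∑' k, w k)
  · rw [← mul_div_assoc]
    refine div_le_div_of_nonneg_right ?_ htot.le
    rw [← div_le_iff₀' two_pos, ← one_div_mul_eq_div, ← le_div_iff₀ (hwpos n), hratio]
    have hge : (4 / 5 : ℝ) ≤ (5 + |(n : ℝ)|) / (5 + |((n + 1 : ℤ) : ℝ)|) := by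
      rw [le_div_iff₀ (hbase _)]
      linarith [(habs n).1, abs_nonneg (n : ℝ)]
    refine le_trans ?_ (pow_le_pow_left₀ (by norm_num) hge 3)
    norm_num
  · have hlim : Tendsto (fun n : ℤ => (5 + |(n : ℝ)|) / (5 + |((n + 1 : ℤ) : ℝ)|)) cofinite
        (𝓝 1) := by
      have hsmall : Tendsto (fun n : ℤ => 2 * (1 / (5 + |(n : ℝ)|))) cofinite (𝓝 0) := by
        have hsq := (summable_one_div_five_add_abs_pow (p := 2) (by norm_num)).tendsto_cofinite_zero
        have := (Real.continuous_sqrt.tendsto 0).comp hsq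
        simp only [Real.sqrt_zero] at this
        rw [← mul_zero (2 : ℝ)]
        refine Tendsto.const_mul 2 (this.congr fun n => ?_)
        rw [Function.comp_apply, ← one_div_pow, Real.sqrt_sq (one_div_pos.2 (hbase n)).le]
      rw [tendsto_iff_dist_tendsto_zero]
      refine squeeze_zero (fun _ => dist_nonneg) (fun n => ?_) hsmall
      have hb := hbase n
      have hb' := hbase (n + 1)
      rw [Real.dist_eq, div_sub_one hb'.ne', abs_div, abs_of_pos hb', mul_one_div,
        div_le_div_iff₀ hb' hb]
      have h1 : |5 + |(n : ℝ)| - (5 + |((n + 1 : ℤ) : ℝ)|)| ≤ 1 :=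
        abs_le.2 ⟨by linarith [(habs n).1], by linarith [(habs n).2]⟩
      nlinarith [(habs n).2, abs_nonneg ((n + 1 : ℤ) : ℝ)]
    have hcongr : ∀ n, (w (n + 1) / ∑' k, w k) / (w n / ∑' k, w k) =
        ((5 + |(n : ℝ)|) / (5 + |((n + 1 : ℤ) : ℝ)|)) ^ 3 := fun n => by
      rw [div_div_div_cancel_right₀ htot.ne', hratio]
    simp only [hcongr]
    simpa using (hlim.pow 3).sub_const 1

/-! ### From lifts to circle homeomorphisms -/

namespace CircleDeg1Lift

/-- The circle map induced by a degree one lift. -/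
def toCircleMap (f : CircleDeg1Lift) : AddCircle (1 : ℝ) → AddCircle (1 : ℝ) :=
  Function.Periodic.lift (f := fun x => ((f x : ℝ) : AddCircle (1 : ℝ))) (c := 1) fun x => by
    simp only [f.map_add_one, AddCircle.coe_add, AddCircle.coe_period, add_zero]

theorem toCircleMap_coe (f : CircleDeg1Lift) (x : ℝ) :
    f.toCircleMap x = ((f x : ℝ) : AddCircle (1 : ℝ)) := rfl

theorem continuous_toCircleMap {f : CircleDeg1Lift} (hf : Continuous f) :
    Continuous f.toCircleMap :=
  continuous_quot_lift _ ((AddCircle.continuous_mk' 1).comp hf)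

/-- The circle homeomorphism induced by an invertible degree one lift. -/
def toCircleHomeomorph (F : CircleDeg1Liftˣ) : AddCircle (1 : ℝ) ≃ₜ AddCircle (1 : ℝ) where
  toFun := toCircleMap F
  invFun := toCircleMap (F⁻¹ : CircleDeg1Liftˣ)
  left_inv x := by
    induction x using QuotientAddGroup.induction_on with
    | H x => simp only [toCircleMap_coe, units_inv_apply_apply]
  right_inv x := by
    induction x using QuotientAddGroup.induction_on with
    | H x => simp only [toCircleMap_coe, units_apply_inv_apply]
  continuous_toFun := continuous_toCircleMap (toOrderIso F).continuous
  continuous_invFun := continuous_toCircleMap (toOrderIso F⁻¹).continuous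

theorem toCircleHomeomorph_coe (F : CircleDeg1Liftˣ) (x : ℝ) :
    toCircleHomeomorph F x = ((F x : ℝ) : AddCircle (1 : ℝ)) := rfl

end CircleDeg1Lift

/-- The gap ending at `jumpSum ℓ α 0` projects to an open set missed by the image of `jumpSum`. -/
theorem IsGapLength.not_dense_of_forall_eq_jumpSum {ℓ : ℤ → ℝ} (h : IsGapLength ℓ) {α : ℝ}
    {S : Set (AddCircle (1 : ℝ))}
    (hS : ∀ y ∈ S, ∃ t, y = ((jumpSum ℓ α t : ℝ) : AddCircle (1 : ℝ))) : ¬ Dense S := by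
  intro hdense
  have hpos := h.pos 0
  have hopen : IsOpen ((fun x : ℝ => (x : AddCircle (1 : ℝ))) ''
      Ioo (jumpSum ℓ α 0 - ℓ 0) (jumpSum ℓ α 0)) :=
    QuotientAddGroup.isOpenMap_coe _ isOpen_Ioo
  obtain ⟨_, ⟨z, ⟨hz, hz'⟩, rfl⟩, hzS⟩ := hdense.inter_open_nonempty _ hopen
    ((nonempty_Ioo.2 (by linarith)).image _)
  obtain ⟨t, ht⟩ := hS _ hzS
  obtain ⟨m, hm⟩ := (AddCircle.coe_eq_zero_iff 1).1
    ((AddCircle.coe_sub 1 z (jumpSum ℓ α t)).trans (sub_eq_zero.2 ht))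
  have hzt : z = jumpSum ℓ α (t + m) := by
    rw [h.jumpSum_add_int]
    rw [zsmul_one] at hm
    linarith
  rcases lt_or_ge (t + m) 0 with hneg | hnonneg
  · have hle := h.jumpSum_add_le (α := α) (k := 0) (m := 0) (by simpa using hneg)
    simp only [Int.cast_zero, zero_mul, add_zero] at hle
    linarith
  · linarith [h.jumpSum_mono α hnonneg]

theorem exists_denjoy_counterexample_constant_type :
    ∃ (R : AddCircle (1:ℝ) ≃ₜ AddCircle (1:ℝ)) (F : CircleDeg1Liftˣ),
      (∀ x : ℝ, R ↑x = ↑((F : CircleDeg1Lift) x)) ∧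
      ContDiff ℝ 1 ⇑(F : CircleDeg1Lift) ∧
      ContDiff ℝ 1 ⇑((F⁻¹ : CircleDeg1Liftˣ) : CircleDeg1Lift) ∧
      IsOfConstantType ((F : CircleDeg1Lift).translationNumber) ∧
      ∃ x : AddCircle (1:ℝ),
        ¬ Dense {y : AddCircle (1:ℝ) |
            ∃ n : ℕ, y = (⇑R)^[n] x ∨ y = (⇑R.symm)^[n] x} := by
  obtain ⟨ℓ, h⟩ := exists_isGapLength
  have hα := Real.goldenRatio_irrational
  obtain ⟨F, hF⟩ := h.isUnit_denjoyLift hα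
  have hFmap : ∀ x, (F : CircleDeg1Lift) x = denjoyMap ℓ Real.goldenRatio x := fun x => by
    rw [hF]
    rfl
  have hC1 : ContDiff ℝ 1 ⇑(F : CircleDeg1Lift) := by
    rw [funext hFmap]
    exact h.contDiff_denjoyMap hα
  have hstep : ∀ t, CircleDeg1Lift.toCircleHomeomorph F (jumpSum ℓ Real.goldenRatio t : ℝ) =
      ((jumpSum ℓ Real.goldenRatio (t + Real.goldenRatio) : ℝ) : AddCircle (1 : ℝ)) := fun t => by
    rw [CircleDeg1Lift.toCircleHomeomorph_coe, hFmap, h.denjoyMap_jumpSum]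
  refine ⟨CircleDeg1Lift.toCircleHomeomorph F, F, CircleDeg1Lift.toCircleHomeomorph_coe F, hC1,
    ?_, ?_, ((jumpSum ℓ Real.goldenRatio 0 : ℝ) : AddCircle (1 : ℝ)), ?_⟩
  · exact (CircleDeg1Lift.toOrderIso F).toHomeomorph.contDiff_symm_deriv
      (fun x => (h.denjoyDeriv_pos hα x).ne')
      (fun x => (h.hasDerivAt_denjoyMap hα x).congr_of_eventuallyEq (Eventually.of_forall hFmap))
      hC1
  · rw [hF, h.translationNumber_denjoyLift hα]
    exact isOfConstantType_goldenRatio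
  · refine h.not_dense_of_forall_eq_jumpSum (α := Real.goldenRatio) ?_
    rintro y ⟨n, rfl | rfl⟩
    · induction n with
      | zero => exact ⟨0, rfl⟩
      | succ n ih =>
        obtain ⟨t, ht⟩ := ih
        exact ⟨t + Real.goldenRatio, by rw [Function.iterate_succ_apply', ht, hstep]⟩
    · induction n with
      | zero => exact ⟨0, rfl⟩
      | succ n ih =>
        obtain ⟨t, ht⟩ := ih
        refine ⟨t - Real.goldenRatio, ?_⟩
        rw [Function.iterate_succ_apply', ht, Homeomorph.symm_apply_eq, hstep, sub_add_cancel]
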